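/- arXiv:2207.03438 — 4 statements merged into one kernel-verified Lean document; each statement's English description precedes it below -/
import Mathlib

section
/- For any initial balance x > x*, the strategy α*(t) := M(t) for t ∈ [0, t_c] and α*(t) := m(t) for t ∈ (t_c, T] belongs to 𝒜, attains the infimum defining v(x) (i.e. J(x, α*) = v(x)), and v(x) = v1(x). -/
open MeasureTheory Set

noncomputable section

/-- Admissible repayment strategies: measurable, with `m t ≤ α t ≤ M t` on `[0,T]`. -/
def Adm (T : ℝ) (m M : ℝ → ℝ) : Set (ℝ → ℝ) :=
  {α | Measurable α ∧ ∀ t ∈ Icc (0:ℝ) T, m t ≤ α t ∧ α t ≤ M t}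

/-- Compound-interest balance. -/
def balC (r β x : ℝ) (α : ℝ → ℝ) (t : ℝ) : ℝ :=
  Real.exp ((r + β) * t) * (x - ∫ s in (0:ℝ)..t, Real.exp (-(r + β) * s) * α s)

/-- Terminal time: first zero of the balance in `[0,T]`, capped at `T`. -/
def tauC (r β T x : ℝ) (α : ℝ → ℝ) : ℝ :=
  sInf (insert T {t | t ∈ Icc (0:ℝ) T ∧ balC r β x α t = 0})

/-- Repayment cost. -/
def costC (r β T ω x : ℝ) (α : ℝ → ℝ) : ℝ :=
  (∫ t in (0:ℝ)..(tauC r β T x α), Real.exp (-r * t) * α t)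
    + ω * Real.exp (-r * tauC r β T x α) * balC r β x α (tauC r β T x α)

/-- Value function. -/
def valC (r β T ω : ℝ) (m M : ℝ → ℝ) (x : ℝ) : ℝ :=
  sInf (costC r β T ω x '' Adm T m M)

/-- Critical horizon `t_c = max(T + log ω / β, 0)`. -/
def tCrit (β T ω : ℝ) : ℝ := max (T + Real.log ω / β) 0

/-- The cost `v₁` of the max-min strategy. -/
def vOne (r β T ω : ℝ) (m M : ℝ → ℝ) (x : ℝ) : ℝ :=
  (∫ s in (0:ℝ)..(tCrit β T ω), Real.exp (-r * s) * M s)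
  + (∫ s in (tCrit β T ω)..T, Real.exp (-r * s) * m s)
  + ω * Real.exp (β * T) *
    (x - (∫ s in (0:ℝ)..(tCrit β T ω), Real.exp (-(r + β) * s) * M s)
       - ∫ s in (tCrit β T ω)..T, Real.exp (-(r + β) * s) * m s)

/-- `x̂ = ∫_0^{t_c} e^{-(r+β)s} M(s) ds`. -/
def xHat (r β T ω : ℝ) (M : ℝ → ℝ) : ℝ :=
  ∫ s in (0:ℝ)..(tCrit β T ω), Real.exp (-(r + β) * s) * M s

/-- `x̄ = ∫_0^T e^{-(r+β)s} M(s) ds`. -/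
def xBar (r β T : ℝ) (M : ℝ → ℝ) : ℝ :=
  ∫ s in (0:ℝ)..T, Real.exp (-(r + β) * s) * M s

/-- `x̲ = ∫_0^T e^{-(r+β)s} m(s) ds`. -/
def xLow (r β T : ℝ) (m : ℝ → ℝ) : ℝ :=
  ∫ s in (0:ℝ)..T, Real.exp (-(r + β) * s) * m s

/-- `x_c = ∫_0^{t_c} e^{-(r+β)s} M(s) ds + ∫_{t_c}^T e^{-(r+β)s} m(s) ds`. -/
def xCrit (r β T ω : ℝ) (m M : ℝ → ℝ) : ℝ :=
  xHat r β T ω M + ∫ s in (tCrit β T ω)..T, Real.exp (-(r + β) * s) * m s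

/-- Weight of a unit of discounted repayment at time `s` in the cost. -/
def costWeight (β T ω s : ℝ) : ℝ := Real.exp (β * s) - ω * Real.exp (β * T)

lemma costWeight_mono {β : ℝ} (hβ : 0 < β) (T ω : ℝ) : Monotone (costWeight β T ω) := by
  intro a b hab
  have := Real.exp_le_exp.2 (mul_le_mul_of_nonneg_left hab hβ.le)
  unfold costWeight
  linarith

lemma continuous_costWeight (β T ω : ℝ) : Continuous (costWeight β T ω) := by
  unfold costWeight
  fun_prop

lemma mul_exp_eq_exp {β ω : ℝ} (T : ℝ) (hβ : 0 < β) (hω : 0 < ω) :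
    ω * Real.exp (β * T) = Real.exp (β * (T + Real.log ω / β)) := by
  rw [mul_add, mul_div_cancel₀ _ hβ.ne', Real.exp_add, Real.exp_log hω, mul_comm]

lemma costWeight_pos {β T ω s : ℝ} (hβ : 0 < β) (hω : 0 < ω) (hs : tCrit β T ω < s) :
    0 < costWeight β T ω s := by
  have h : T + Real.log ω / β < s := (le_max_left _ _).trans_lt hs
  rw [costWeight, mul_exp_eq_exp T hβ hω, sub_pos]
  exact Real.exp_lt_exp.2 (mul_lt_mul_of_pos_left h hβ)

lemma costWeight_nonpos {β T ω s : ℝ} (hβ : 0 < β) (hω : 0 < ω) (h0 : 0 < s)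
    (hs : s ≤ tCrit β T ω) : costWeight β T ω s ≤ 0 := by
  have h : s ≤ T + Real.log ω / β := (le_max_iff.1 hs).resolve_right h0.not_ge
  rw [costWeight, mul_exp_eq_exp T hβ hω, sub_nonpos]
  exact Real.exp_le_exp.2 (mul_le_mul_of_nonneg_left h hβ.le)

lemma exp_neg_mul_eq (r β s a : ℝ) :
    Real.exp (-r * s) * a = Real.exp (-(r + β) * s) * a * Real.exp (β * s) := by
  rw [mul_right_comm, ← Real.exp_add]
  ring_nf

lemma discounted_mul_costWeight (r β T ω s a : ℝ) :
    Real.exp (-(r + β) * s) * a * costWeight β T ω s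
      = Real.exp (-r * s) * a * (1 - ω * Real.exp (β * (T - s))) := by
  rw [exp_neg_mul_eq r β, mul_assoc _ (Real.exp (β * s)), costWeight, mul_one_sub,
    mul_left_comm (Real.exp (β * s)) ω, ← Real.exp_add]
  ring_nf

/-- An integrable function stays integrable on subintervals after multiplication by a
continuous factor. -/
lemma intervalIntegrable_continuous_mul {T : ℝ} {f g : ℝ → ℝ} (hf : IntegrableOn f (Icc (0:ℝ) T))
    (hg : Continuous g) {a b : ℝ} (ha : a ∈ Icc (0:ℝ) T) (hb : b ∈ Icc (0:ℝ) T) :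
    IntervalIntegrable (fun s => g s * f s) volume a b := by
  refine IntervalIntegrable.continuousOn_mul ?_ hg.continuousOn
  exact (hf.mono_set (uIcc_subset_Icc ha hb)).intervalIntegrable

lemma intervalIntegrable_discounted {T : ℝ} {f : ℝ → ℝ} (hf : IntegrableOn f (Icc (0:ℝ) T))
    (r β : ℝ) {a b : ℝ} (ha : a ∈ Icc (0:ℝ) T) (hb : b ∈ Icc (0:ℝ) T) :
    IntervalIntegrable (fun s => Real.exp (-(r + β) * s) * f s) volume a b :=
  intervalIntegrable_continuous_mul hf (by fun_prop) ha hb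

lemma intervalIntegrable_weighted {T : ℝ} {f : ℝ → ℝ} (hf : IntegrableOn f (Icc (0:ℝ) T))
    (r β ω : ℝ) {a b : ℝ} (ha : a ∈ Icc (0:ℝ) T) (hb : b ∈ Icc (0:ℝ) T) :
    IntervalIntegrable (fun s => Real.exp (-(r + β) * s) * f s * costWeight β T ω s)
      volume a b :=
  (intervalIntegrable_discounted hf r β ha hb).mul_continuousOn
    (continuous_costWeight β T ω).continuousOn

lemma integrableOn_of_mem_Adm {T : ℝ} {m M α : ℝ → ℝ} (hMInt : IntegrableOn M (Icc (0:ℝ) T))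
    (hm : ∀ t ∈ Icc (0:ℝ) T, 0 < m t) (hα : α ∈ Adm T m M) : IntegrableOn α (Icc (0:ℝ) T) := by
  refine Integrable.mono' hMInt hα.1.aestronglyMeasurable ?_
  refine (ae_restrict_iff' measurableSet_Icc).2 (Filter.Eventually.of_forall fun t ht => ?_)
  rw [Real.norm_of_nonneg ((hm t ht).le.trans (hα.2 t ht).1)]
  exact (hα.2 t ht).2

/-- The discounted cost and the weighted cost of a repayment strategy agree up to the
discounted balance. -/
lemma integral_weighted {T : ℝ} {f : ℝ → ℝ} (hf : IntegrableOn f (Icc (0:ℝ) T))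
    (r β ω : ℝ) {a b : ℝ} (ha : a ∈ Icc (0:ℝ) T) (hb : b ∈ Icc (0:ℝ) T) :
    ∫ s in a..b, Real.exp (-(r + β) * s) * f s * costWeight β T ω s
      = (∫ s in a..b, Real.exp (-r * s) * f s)
        - ω * Real.exp (β * T) * ∫ s in a..b, Real.exp (-(r + β) * s) * f s := by
  rw [← intervalIntegral.integral_const_mul, ← intervalIntegral.integral_sub
    (intervalIntegrable_continuous_mul hf (by fun_prop) ha hb)
    ((intervalIntegrable_discounted hf r β ha hb).const_mul _)]
  refine intervalIntegral.integral_congr fun s _ => ?_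
  simp only [costWeight]
  rw [exp_neg_mul_eq r β]
  ring

lemma continuousOn_balC {T : ℝ} {α : ℝ → ℝ} (hT : 0 ≤ T) (hα : IntegrableOn α (Icc (0:ℝ) T))
    (r β x : ℝ) : ContinuousOn (balC r β x α) (Icc (0:ℝ) T) := by
  have h := intervalIntegral.continuousOn_primitive_interval' (μ := volume)
    (intervalIntegrable_discounted hα r β (left_mem_Icc.2 hT) (right_mem_Icc.2 hT))
    (left_mem_uIcc)
  rw [uIcc_of_le hT] at h
  unfold balC
  exact ContinuousOn.mul (by fun_prop) (continuousOn_const.sub h)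

lemma balC_eq_zero_iff {r β x t : ℝ} {α : ℝ → ℝ} :
    balC r β x α t = 0 ↔ x = ∫ s in (0:ℝ)..t, Real.exp (-(r + β) * s) * α s := by
  simp [balC, Real.exp_ne_zero, sub_eq_zero]

lemma tauC_eq_or {T : ℝ} {α : ℝ → ℝ} (hT : 0 ≤ T) (hα : IntegrableOn α (Icc (0:ℝ) T))
    (r β x : ℝ) : tauC r β T x α = T ∨
      tauC r β T x α ∈ Icc (0:ℝ) T ∧ balC r β x α (tauC r β T x α) = 0 := by
  have hc : IsClosed {t | t ∈ Icc (0:ℝ) T ∧ balC r β x α t = 0} :=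
    (continuousOn_balC hT hα r β x).preimage_isClosed_of_isClosed isClosed_Icc isClosed_singleton
  have hc' : IsClosed (insert T {t | t ∈ Icc (0:ℝ) T ∧ balC r β x α t = 0}) := by
    rw [insert_eq]
    exact isClosed_singleton.union hc
  refine hc'.csInf_mem (insert_nonempty _ _) ⟨0, ?_⟩
  rintro t (rfl | ht)
  exacts [hT, ht.1.1]

lemma costC_eq {T : ℝ} {α : ℝ → ℝ} (hT : 0 ≤ T) (hα : IntegrableOn α (Icc (0:ℝ) T))
    (r β ω x : ℝ) : costC r β T ω x α = ω * Real.exp (β * T) * x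
      + ∫ s in (0:ℝ)..(tauC r β T x α),
          Real.exp (-(r + β) * s) * α s * costWeight β T ω s := by
  have h0 : (0:ℝ) ∈ Icc (0:ℝ) T := left_mem_Icc.2 hT
  rcases tauC_eq_or hT hα r β x with h | ⟨h, hb⟩
  · rw [costC, h, integral_weighted hα r β ω h0 (right_mem_Icc.2 hT), balC,
      mul_assoc ω, ← mul_assoc (Real.exp (-r * T)), ← Real.exp_add]
    ring_nf
  · rw [integral_weighted hα r β ω h0 h, costC, hb, ← balC_eq_zero_iff.1 hb]
    ring

lemma weighted_sub_ge {r β T ω u τ : ℝ} {m M α : ℝ → ℝ} (hβ : 0 < β)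
    (hMInt : IntegrableOn M (Icc (0:ℝ) T)) (hm : ∀ t ∈ Icc (0:ℝ) T, 0 < m t)
    (hα : α ∈ Adm T m M) (hu : u ∈ Icc (0:ℝ) T) (hτ : τ ∈ Icc u T) :
    costWeight β T ω u * ((∫ s in (0:ℝ)..τ, Real.exp (-(r + β) * s) * α s)
        - ∫ s in (0:ℝ)..u, Real.exp (-(r + β) * s) * M s)
      ≤ (∫ s in (0:ℝ)..τ, Real.exp (-(r + β) * s) * α s * costWeight β T ω s)
        - ∫ s in (0:ℝ)..u, Real.exp (-(r + β) * s) * M s * costWeight β T ω s := by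
  have hαI := integrableOn_of_mem_Adm hMInt hm hα
  have h0 : (0:ℝ) ∈ Icc (0:ℝ) T := left_mem_Icc.2 (hu.1.trans hu.2)
  have hτ' : τ ∈ Icc (0:ℝ) T := ⟨hu.1.trans hτ.1, hτ.2⟩
  have before : (∫ s in (0:ℝ)..u, (Real.exp (-(r + β) * s) * α s - Real.exp (-(r + β) * s) * M s)
        * costWeight β T ω u)
      ≤ ∫ s in (0:ℝ)..u, (Real.exp (-(r + β) * s) * α s * costWeight β T ω s
        - Real.exp (-(r + β) * s) * M s * costWeight β T ω s) := by
    refine intervalIntegral.integral_mono_on hu.1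
      (((intervalIntegrable_discounted hαI r β h0 hu).sub
        (intervalIntegrable_discounted hMInt r β h0 hu)).mul_const _)
      ((intervalIntegrable_weighted hαI r β ω h0 hu).sub
        (intervalIntegrable_weighted hMInt r β ω h0 hu)) fun s hs => ?_
    have h1 := (hα.2 s ⟨hs.1, hs.2.trans hu.2⟩).2
    have h2 := costWeight_mono hβ T ω hs.2
    have h3 := mul_nonneg (mul_nonneg (Real.exp_pos (-(r + β) * s)).le (sub_nonneg.2 h1))
      (sub_nonneg.2 h2)
    linarith
  have after : (∫ s in u..τ, Real.exp (-(r + β) * s) * α s * costWeight β T ω u)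
      ≤ ∫ s in u..τ, Real.exp (-(r + β) * s) * α s * costWeight β T ω s := by
    refine intervalIntegral.integral_mono_on hτ.1
      ((intervalIntegrable_discounted hαI r β hu hτ').mul_const _)
      (intervalIntegrable_weighted hαI r β ω hu hτ') fun s hs => ?_
    have hs' : s ∈ Icc (0:ℝ) T := ⟨hu.1.trans hs.1, hs.2.trans hτ.2⟩
    exact mul_le_mul_of_nonneg_left (costWeight_mono hβ T ω hs.1)
      (mul_nonneg (Real.exp_pos _).le ((hm s hs').le.trans (hα.2 s hs').1))
  rw [intervalIntegral.integral_mul_const, intervalIntegral.integral_sub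
      (intervalIntegrable_discounted hαI r β h0 hu)
      (intervalIntegrable_discounted hMInt r β h0 hu),
    intervalIntegral.integral_sub (intervalIntegrable_weighted hαI r β ω h0 hu)
      (intervalIntegrable_weighted hMInt r β ω h0 hu)] at before
  rw [intervalIntegral.integral_mul_const] at after
  rw [← intervalIntegral.integral_add_adjacent_intervals
      (intervalIntegrable_discounted hαI r β h0 hu) (intervalIntegrable_discounted hαI r β hu hτ'),
    ← intervalIntegral.integral_add_adjacent_intervals
      (intervalIntegrable_weighted hαI r β ω h0 hu) (intervalIntegrable_weighted hαI r β ω hu hτ')]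
  linarith

lemma tCrit_nonneg (β T ω : ℝ) : 0 ≤ tCrit β T ω := le_max_right _ _

/-- The weighted cost over the whole period is minimised by the max-min strategy. -/
lemma weighted_maxMin_le {r β T ω : ℝ} {m M α : ℝ → ℝ} (hβ : 0 < β) (hω : 0 < ω)
    (hmInt : IntegrableOn m (Icc (0:ℝ) T)) (hMInt : IntegrableOn M (Icc (0:ℝ) T))
    (hm : ∀ t ∈ Icc (0:ℝ) T, 0 < m t) (htc : tCrit β T ω ≤ T) (hα : α ∈ Adm T m M) :
    (∫ s in (0:ℝ)..(tCrit β T ω), Real.exp (-(r + β) * s) * M s * costWeight β T ω s)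
        + ∫ s in (tCrit β T ω)..T, Real.exp (-(r + β) * s) * m s * costWeight β T ω s
      ≤ ∫ s in (0:ℝ)..T, Real.exp (-(r + β) * s) * α s * costWeight β T ω s := by
  have hαI := integrableOn_of_mem_Adm hMInt hm hα
  have hc0 := tCrit_nonneg β T ω
  have h0 : (0:ℝ) ∈ Icc (0:ℝ) T := left_mem_Icc.2 (hc0.trans htc)
  have hT : T ∈ Icc (0:ℝ) T := right_mem_Icc.2 (hc0.trans htc)
  have hc : tCrit β T ω ∈ Icc (0:ℝ) T := ⟨hc0, htc⟩
  rw [← intervalIntegral.integral_add_adjacent_intervals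
      (intervalIntegrable_weighted hαI r β ω h0 hc) (intervalIntegrable_weighted hαI r β ω hc hT)]
  refine add_le_add ?_ ?_
  · refine intervalIntegral.integral_mono_on_of_le_Ioo hc0
      (intervalIntegrable_weighted hMInt r β ω h0 hc)
      (intervalIntegrable_weighted hαI r β ω h0 hc) fun s hs => ?_
    exact mul_le_mul_of_nonpos_right
      (mul_le_mul_of_nonneg_left (hα.2 s ⟨hs.1.le, hs.2.le.trans htc⟩).2 (Real.exp_pos _).le)
      (costWeight_nonpos hβ hω hs.1 hs.2.le)
  · refine intervalIntegral.integral_mono_on_of_le_Ioo htc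
      (intervalIntegrable_weighted hmInt r β ω hc hT)
      (intervalIntegrable_weighted hαI r β ω hc hT) fun s hs => ?_
    exact mul_le_mul_of_nonneg_right
      (mul_le_mul_of_nonneg_left (hα.2 s ⟨hc0.trans hs.1.le, hs.2.le⟩).1 (Real.exp_pos _).le)
      (costWeight_pos hβ hω hs.1).le

lemma integral_switch {T c : ℝ} {M m : ℝ → ℝ} {F : ℝ → ℝ → ℝ} (h0 : 0 ≤ c) (hc : c ≤ T)
    (hi : IntervalIntegrable (fun s => F s (if s ≤ c then M s else m s)) volume 0 T) :
    ∫ s in (0:ℝ)..T, F s (if s ≤ c then M s else m s)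
      = (∫ s in (0:ℝ)..c, F s (M s)) + ∫ s in c..T, F s (m s) := by
  rw [← intervalIntegral.integral_add_adjacent_intervals (b := c)
    (hi.mono_set (uIcc_subset_uIcc left_mem_uIcc (mem_uIcc_of_le h0 hc)))
    (hi.mono_set (uIcc_subset_uIcc (mem_uIcc_of_le h0 hc) right_mem_uIcc))]
  congr 1
  · refine intervalIntegral.integral_congr fun s hs => ?_
    rw [uIcc_of_le h0] at hs
    simp only [if_pos hs.2]
  · refine intervalIntegral.integral_congr_ae (Filter.Eventually.of_forall fun s hs => ?_)
    rw [uIoc_of_le hc] at hs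
    simp only [if_neg hs.1.not_ge]

/-- for `x > x*`, the max-min strategy is admissible, attains the
infimum defining `v(x)`, and `v(x) = v₁(x)`. -/
theorem stmt0 (r β T ω : ℝ) (m M : ℝ → ℝ)
    (hr : 0 < r) (hβ : 0 < β) (hT : 0 < T) (hω : ω ∈ Ioo (0:ℝ) 1)
    (hmMeas : Measurable m) (hMMeas : Measurable M)
    (hmInt : IntegrableOn m (Icc (0:ℝ) T)) (hMInt : IntegrableOn M (Icc (0:ℝ) T))
    (hmM : ∀ t ∈ Icc (0:ℝ) T, 0 < m t ∧ m t < M t)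
    (tstar : ℝ) (htstar : tstar ∈ Ioo (tCrit β T ω) T)
    (htstarEq :
      (∫ s in (tCrit β T ω)..tstar,
        Real.exp (-r * s) * M s * (1 - ω * Real.exp (β * (T - s))))
      = ∫ s in (tCrit β T ω)..T,
        Real.exp (-r * s) * m s * (1 - ω * Real.exp (β * (T - s))))
    (x : ℝ)
    (hx : (∫ s in (0:ℝ)..tstar, Real.exp (-(r + β) * s) * M s) < x) :
    (fun t => if t ≤ tCrit β T ω then M t else m t) ∈ Adm T m M ∧
    costC r β T ω x (fun t => if t ≤ tCrit β T ω then M t else m t)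
      = valC r β T ω m M x ∧
    valC r β T ω m M x = vOne r β T ω m M x := by
  have hc0 := tCrit_nonneg β T ω
  have hcT : tCrit β T ω ≤ T := (htstar.1.trans htstar.2).le
  have hm : ∀ t ∈ Icc (0:ℝ) T, 0 < m t := fun t ht => (hmM t ht).1
  have hu : tstar ∈ Icc (0:ℝ) T := ⟨hc0.trans htstar.1.le, htstar.2.le⟩
  have h0 : (0:ℝ) ∈ Icc (0:ℝ) T := left_mem_Icc.2 hT.le
  have hTT : T ∈ Icc (0:ℝ) T := right_mem_Icc.2 hT.le
  have hc : tCrit β T ω ∈ Icc (0:ℝ) T := ⟨hc0, hcT⟩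
  have hku := costWeight_pos hβ hω.1 htstar.1
  set αs : ℝ → ℝ := fun t => if t ≤ tCrit β T ω then M t else m t with hαs
  have hadm : αs ∈ Adm T m M := by
    refine ⟨Measurable.ite measurableSet_Iic hMMeas hmMeas, fun t ht => ?_⟩
    have h := (hmM t ht).2.le
    simp only [hαs]
    split_ifs
    exacts [⟨h, le_rfl⟩, ⟨le_rfl, h⟩]
  have hsI := integrableOn_of_mem_Adm hMInt hm hadm
  have hswitch := integral_switch (F := fun s a => Real.exp (-(r + β) * s) * a * costWeight β T ω s)
    hc0 hcT (intervalIntegrable_weighted hsI r β ω h0 hTT)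
  have hstar : (∫ s in (0:ℝ)..T, Real.exp (-(r + β) * s) * αs s * costWeight β T ω s)
      = ∫ s in (0:ℝ)..tstar, Real.exp (-(r + β) * s) * M s * costWeight β T ω s := by
    rw [hswitch, ← intervalIntegral.integral_add_adjacent_intervals
      (intervalIntegrable_weighted hMInt r β ω h0 hc)
      (intervalIntegrable_weighted hMInt r β ω hc hu)]
    simp only [discounted_mul_costWeight, htstarEq]
  have htotal : (∫ s in (0:ℝ)..T, Real.exp (-(r + β) * s) * αs s) < x := by
    have h := weighted_sub_ge (r := r) (ω := ω) hβ hMInt hm hadm hu ⟨hu.2, le_rfl⟩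
    rw [hstar, sub_self] at h
    linarith [nonpos_of_mul_nonpos_right h hku]
  have hpos : ∀ α ∈ Adm T m M, ∀ t ∈ Icc (0:ℝ) T, 0 ≤ Real.exp (-(r + β) * t) * α t :=
    fun α hα t ht => mul_nonneg (Real.exp_pos _).le ((hm t ht).le.trans (hα.2 t ht).1)
  have htau : tauC r β T x αs = T := by
    rcases tauC_eq_or hT.le hsI r β x with h | ⟨h, hb⟩
    · exact h
    · have hsplit := intervalIntegral.integral_add_adjacent_intervals
        (intervalIntegrable_discounted hsI r β h0 h) (intervalIntegrable_discounted hsI r β h hTT)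
      have hrest := intervalIntegral.integral_nonneg (μ := volume) h.2 fun s hs =>
        hpos αs hadm s ⟨h.1.trans hs.1, hs.2⟩
      linarith [balC_eq_zero_iff.1 hb]
  have hcost : costC r β T ω x αs = ω * Real.exp (β * T) * x
      + ∫ s in (0:ℝ)..T, Real.exp (-(r + β) * s) * αs s * costWeight β T ω s := by
    rw [costC_eq hT.le hsI, htau]
  have hmin : ∀ α ∈ Adm T m M, costC r β T ω x αs ≤ costC r β T ω x α := by
    intro α hα
    have hαI := integrableOn_of_mem_Adm hMInt hm hα
    rw [hcost, costC_eq hT.le hαI]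
    refine add_le_add le_rfl ?_
    rcases tauC_eq_or hT.le hαI r β x with h | ⟨h, hb⟩
    · rw [h, hswitch]
      exact weighted_maxMin_le hβ hω.1 hmInt hMInt hm hcT hα
    · have hx' := balC_eq_zero_iff.1 hb
      have hle : tstar ≤ tauC r β T x α := by
        by_contra! hlt
        have h1 := intervalIntegral.integral_mono_on h.1
          (intervalIntegrable_discounted hαI r β h0 h)
          (intervalIntegrable_discounted hMInt r β h0 h) fun s hs =>
            mul_le_mul_of_nonneg_left (hα.2 s ⟨hs.1, hs.2.trans h.2⟩).2 (Real.exp_pos _).le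
        have h2 := intervalIntegral.integral_add_adjacent_intervals
          (intervalIntegrable_discounted hMInt r β h0 h)
          (intervalIntegrable_discounted hMInt r β h hu)
        have h3 : 0 ≤ ∫ s in (tauC r β T x α)..tstar, Real.exp (-(r + β) * s) * M s :=
          intervalIntegral.integral_nonneg hlt.le fun s hs => by
            have hs' : s ∈ Icc (0:ℝ) T := ⟨h.1.trans hs.1, hs.2.trans hu.2⟩
            exact mul_nonneg (Real.exp_pos _).le ((hmM s hs').1.trans (hmM s hs').2).le
        linarith
      have h4 := weighted_sub_ge (r := r) (ω := ω) hβ hMInt hm hα hu ⟨hle, h.2⟩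
      rw [← hx'] at h4
      rw [hstar]
      linarith [mul_pos hku (sub_pos.2 hx)]
  have hval : costC r β T ω x αs = valC r β T ω m M x := by
    have hleast : IsLeast (costC r β T ω x '' Adm T m M) (costC r β T ω x αs) :=
      ⟨mem_image_of_mem _ hadm, forall_mem_image.2 hmin⟩
    exact hleast.csInf_eq.symm
  refine ⟨hadm, hval, ?_⟩
  rw [← hval, hcost, hswitch, integral_weighted hMInt r β ω h0 hc,
    integral_weighted hmInt r β ω hc hTT, vOne]
  ring
end
end

section
/- There exists a unique t* ∈ (t_c, T) such that ∫_{t_c}^{t*} e^{−rs} M(s)(1 − ω e^{β(T−s)}) ds = ∫_{t_c}^{T} e^{−rs} m(s)(1 − ω e^{β(T−s)}) ds. -/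
open MeasureTheory Set

noncomputable section

/-- If `0 < g < f` on `(a, b)`, then the primitive of `f` starting at `a` attains the value
`∫ s in a..b, g s` at exactly one point of `(a, b)`. -/
theorem existsUnique_intervalIntegral_eq_of_pos_of_lt {f g : ℝ → ℝ} {a b : ℝ} (hab : a < b)
    (hf : IntervalIntegrable f volume a b) (hg : IntervalIntegrable g volume a b)
    (hg_pos : ∀ s ∈ Ioo a b, 0 < g s) (hgf : ∀ s ∈ Ioo a b, g s < f s) :
    ∃! t : ℝ, t ∈ Ioo a b ∧ (∫ s in a..t, f s) = ∫ s in a..b, g s := by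
  have hsub : ∀ x ∈ Icc a b, ∀ y ∈ Icc a b, IntervalIntegrable f volume x y := fun x hx y hy =>
    hf.mono_set (by
      rw [uIcc_of_le hab.le]
      exact uIcc_subset_Icc hx hy)
  have ha : a ∈ Icc a b := left_mem_Icc.2 hab.le
  have hmono : StrictMonoOn (fun t => ∫ s in a..t, f s) (Icc a b) := by
    intro x hx y hy hxy
    have hpos : 0 < ∫ s in x..y, f s :=
      intervalIntegral.intervalIntegral_pos_of_pos_on (hsub x hx y hy)
        (fun s hs =>
          have hs' : s ∈ Ioo a b := ⟨hx.1.trans_lt hs.1, hs.2.trans_le hy.2⟩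
          (hg_pos s hs').trans (hgf s hs')) hxy
    have hadd := intervalIntegral.integral_add_adjacent_intervals
      (hsub a ha x hx) (hsub x hx y hy)
    change (∫ s in a..x, f s) < ∫ s in a..y, f s
    linarith
  have hcont : ContinuousOn (fun t => ∫ s in a..t, f s) (Icc a b) := by
    have h := intervalIntegral.continuousOn_primitive_interval' hf left_mem_uIcc
    rwa [uIcc_of_le hab.le] at h
  have hg_int : 0 < ∫ s in a..b, g s :=
    intervalIntegral.intervalIntegral_pos_of_pos_on hg hg_pos hab
  have hgf_int : 0 < ∫ s in a..b, (f s - g s) :=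
    intervalIntegral.intervalIntegral_pos_of_pos_on (hf.sub hg)
      (fun s hs => sub_pos.2 (hgf s hs)) hab
  rw [intervalIntegral.integral_sub hf hg, sub_pos] at hgf_int
  obtain ⟨t, ht, hteq⟩ := intermediate_value_Ioo hab.le hcont
    ⟨by simpa using hg_int, hgf_int⟩
  exact ⟨t, ⟨ht, hteq⟩, fun y hy => hmono.injOn (Ioo_subset_Icc_self hy.1)
    (Ioo_subset_Icc_self ht) (hy.2.trans hteq.symm)⟩

/-- The weight `1 - ω e^{β(T-s)}` is positive after the critical horizon. -/
theorem one_sub_mul_exp_pos_of_tCrit_lt {β T ω s : ℝ} (hβ : 0 < β) (hω : 0 < ω)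
    (hs : tCrit β T ω < s) : 0 < 1 - ω * Real.exp (β * (T - s)) := by
  have h : T + Real.log ω / β < s := (le_max_left _ _).trans_lt hs
  have hlog : Real.log ω + β * (T - s) < 0 := by
    have h' : Real.log ω / β < s - T := by linarith
    rw [div_lt_iff₀ hβ] at h'
    linarith
  rw [sub_pos]
  calc ω * Real.exp (β * (T - s)) = Real.exp (Real.log ω + β * (T - s)) := by
        rw [Real.exp_add, Real.exp_log hω]
    _ < 1 := by simpa using hlog

/-- existence and uniqueness of the critical time `t* ∈ (t_c, T)`. -/
theorem stmt2 (r β T ω : ℝ) (m M : ℝ → ℝ)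
    (hr : 0 < r) (hβ : 0 < β) (hT : 0 < T) (hω : ω ∈ Ioo (0:ℝ) 1)
    (hmMeas : Measurable m) (hMMeas : Measurable M)
    (hmInt : IntegrableOn m (Icc (0:ℝ) T)) (hMInt : IntegrableOn M (Icc (0:ℝ) T))
    (hmM : ∀ t ∈ Icc (0:ℝ) T, 0 < m t ∧ m t < M t) :
    ∃! tstar : ℝ, tstar ∈ Ioo (tCrit β T ω) T ∧
      (∫ s in (tCrit β T ω)..tstar,
        Real.exp (-r * s) * M s * (1 - ω * Real.exp (β * (T - s))))
      = ∫ s in (tCrit β T ω)..T,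
        Real.exp (-r * s) * m s * (1 - ω * Real.exp (β * (T - s))) := by
  have h0 : 0 ≤ tCrit β T ω := le_max_right _ _
  have hlt : tCrit β T ω < T := by
    have h := div_neg_of_neg_of_pos (Real.log_neg hω.1 hω.2) hβ
    exact max_lt (by linarith) hT
  have hint : ∀ u : ℝ → ℝ, IntegrableOn u (Icc (0:ℝ) T) → IntervalIntegrable
      (fun s => Real.exp (-r * s) * u s * (1 - ω * Real.exp (β * (T - s))))
      volume (tCrit β T ω) T := by
    intro u hu
    have hu' : IntervalIntegrable u volume (tCrit β T ω) T :=
      (intervalIntegrable_iff_integrableOn_Icc_of_le hlt.le).2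
        (hu.mono_set (Icc_subset_Icc_left h0))
    exact (hu'.continuousOn_mul (by fun_prop)).mul_continuousOn (by fun_prop)
  refine existsUnique_intervalIntegral_eq_of_pos_of_lt hlt (hint M hMInt) (hint m hmInt) ?_ ?_
  all_goals
    intro s hs
    have hw := one_sub_mul_exp_pos_of_tCrit_lt hβ hω.1 hs.1
    obtain ⟨hm, hmM⟩ := hmM s ⟨h0.trans hs.1.le, hs.2.le⟩
  · positivity
  · gcongr
end
end

section
/- The function x ↦ v1(x) − v2(x) is strictly decreasing on the interval [x̂, x̄], where x̂ := ∫_0^{t_c} e^{−(r+β)s} M(s) ds and x̄ := ∫_0^T e^{−(r+β)s} M(s) ds. -/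
open MeasureTheory Set

noncomputable section

/-- The running integral of a function positive on `[0,T]` is strictly increasing. -/
theorem strictMonoOn_integral_of_pos {T : ℝ} {f : ℝ → ℝ}
    (hf : IntegrableOn f (Icc (0:ℝ) T)) (hpos : ∀ t ∈ Icc (0:ℝ) T, 0 < f t) :
    StrictMonoOn (fun t => ∫ s in (0:ℝ)..t, f s) (Icc (0:ℝ) T) := by
  intro a ha b hb hab
  have hii : ∀ c ∈ Icc (0:ℝ) T, IntervalIntegrable f volume 0 c := fun c hc =>
    (intervalIntegrable_iff_integrableOn_Icc_of_le hc.1).2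
      (hf.mono_set (Icc_subset_Icc_right hc.2))
  have hsub := intervalIntegral.integral_interval_sub_left (hii b hb) (hii a ha)
  have := intervalIntegral.intervalIntegral_pos_of_pos_on
    ((hii a ha).symm.trans (hii b hb))
    (fun t ht => hpos t ⟨ha.1.trans ht.1.le, ht.2.le.trans hb.2⟩) hab
  show (∫ s in (0:ℝ)..a, f s) < ∫ s in (0:ℝ)..b, f s
  linarith

/-- The critical horizon lies in `[0,T]`. -/
theorem tCrit_mem_Icc {β T ω : ℝ} (hβ : 0 < β) (hT : 0 < T) (hω : ω ∈ Ioo (0:ℝ) 1) :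
    tCrit β T ω ∈ Icc (0:ℝ) T := by
  have := div_neg_of_neg_of_pos (Real.log_neg hω.1 hω.2) hβ
  exact ⟨le_max_right _ _, max_le (by linarith) hT.le⟩

/-- Past the critical horizon, discounting at rate `r` dominates `ω e^{βT}` times discounting at
rate `r + β`. -/
theorem mul_exp_lt_exp_of_tCrit_lt {r β T ω s : ℝ} (hβ : 0 < β) (hω : 0 < ω)
    (hs : tCrit β T ω < s) :
    ω * Real.exp (β * T) * Real.exp (-(r + β) * s) < Real.exp (-r * s) := by
  have h1 : T + Real.log ω / β < s := (le_max_left _ _).trans_lt hs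
  have h2 : Real.log ω < β * (s - T) := by
    rw [mul_comm]
    exact (div_lt_iff₀ hβ).1 (by linarith)
  calc ω * Real.exp (β * T) * Real.exp (-(r + β) * s)
      = Real.exp (Real.log ω + β * T + -(r + β) * s) := by
        rw [Real.exp_add, Real.exp_add, Real.exp_log hω]
    _ < Real.exp (-r * s) := Real.exp_lt_exp.2 (by linarith)

/-- `x ↦ v₁(x) − v₂(x)` is strictly decreasing on `[x̂, x̄]`, where
`t_M(x)` is the unique solution in `[0,T]` of `x = ∫_0^{t_M(x)} e^{-(r+β)s} M(s) ds`
and `v₂(x) = ∫_0^{t_M(x)} e^{-rs} M(s) ds`. -/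
theorem stmt8 (r β T ω : ℝ) (m M : ℝ → ℝ)
    (hr : 0 < r) (hβ : 0 < β) (hT : 0 < T) (hω : ω ∈ Ioo (0:ℝ) 1)
    (hmMeas : Measurable m) (hMMeas : Measurable M)
    (hmInt : IntegrableOn m (Icc (0:ℝ) T)) (hMInt : IntegrableOn M (Icc (0:ℝ) T))
    (hmM : ∀ t ∈ Icc (0:ℝ) T, 0 < m t ∧ m t < M t)
    (tM : ℝ → ℝ)
    (htM : ∀ y ∈ Icc (xHat r β T ω M) (xBar r β T M),
      tM y ∈ Icc (0:ℝ) T ∧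
      y = ∫ s in (0:ℝ)..(tM y), Real.exp (-(r + β) * s) * M s) :
    StrictAntiOn
      (fun y => vOne r β T ω m M y
        - ∫ s in (0:ℝ)..(tM y), Real.exp (-r * s) * M s)
      (Icc (xHat r β T ω M) (xBar r β T M)) := by
  have hMpos : ∀ t ∈ Icc (0:ℝ) T, 0 < M t := fun t ht => (hmM t ht).1.trans (hmM t ht).2
  have hint : ∀ k : ℝ, IntegrableOn (fun s => Real.exp (k * s) * M s) (Icc (0:ℝ) T) := fun k =>
    hMInt.continuousOn_mul (by fun_prop) isCompact_Icc
  have hmono := strictMonoOn_integral_of_pos (hint (-(r + β)))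
    (fun t ht => mul_pos (Real.exp_pos _) (hMpos t ht))
  intro a ha b hb hab
  obtain ⟨hta, hae⟩ := htM a ha
  obtain ⟨htb, hbe⟩ := htM b hb
  have htc : tCrit β T ω ≤ tM a :=
    (hmono.le_iff_le (tCrit_mem_Icc hβ hT hω) hta).1 (ha.1.trans hae.le)
  have hlt : tM a < tM b := (hmono.lt_iff_lt hta htb).1 (by
    show (∫ s in (0:ℝ)..(tM a), _) < ∫ s in (0:ℝ)..(tM b), _
    rwa [← hae, ← hbe])
  have hii : ∀ k : ℝ, ∀ c ∈ Icc (0:ℝ) T,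
      IntervalIntegrable (fun s => Real.exp (k * s) * M s) volume 0 c := fun k c hc =>
    (intervalIntegrable_iff_integrableOn_Icc_of_le hc.1).2
      ((hint k).mono_set (Icc_subset_Icc_right hc.2))
  have hab' : ∀ k : ℝ,
      IntervalIntegrable (fun s => Real.exp (k * s) * M s) volume (tM a) (tM b) := fun k =>
    (hii k _ hta).symm.trans (hii k _ htb)
  have hsub := fun k : ℝ =>
    intervalIntegral.integral_interval_sub_left (hii k _ htb) (hii k _ hta)
  have hpos := intervalIntegral.intervalIntegral_pos_of_pos_on
    ((hab' (-r)).sub ((hab' (-(r + β))).const_mul (ω * Real.exp (β * T))))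
    (fun s hs => by
      have h1 := mul_exp_lt_exp_of_tCrit_lt (r := r) hβ hω.1 (htc.trans_lt hs.1)
      have h2 := mul_lt_mul_of_pos_right h1
        (hMpos s ⟨hta.1.trans hs.1.le, hs.2.le.trans htb.2⟩)
      linarith) hlt
  rw [intervalIntegral.integral_sub (hab' (-r)) ((hab' (-(r + β))).const_mul _),
    intervalIntegral.integral_const_mul, ← hsub (-r), ← hsub (-(r + β)), ← hae, ← hbe] at hpos
  simp only [vOne]
  linarith
end
end

section
/- In the simple-interest model: for any x > 0 and α ∈ 𝒜, if θ(α) = T, then J(x, m) ≤ J(x, α), where J(x,m) denotes the cost of the strategy t ↦ m(t). -/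
open MeasureTheory Set

noncomputable section

/-- Running infimum of the balance: the principal. -/
def runInf (b : ℝ → ℝ) (t : ℝ) : ℝ := sInf (b '' Icc (0:ℝ) t)

/-- The simple-interest balance equation: `b` is continuous on `[0,T]`,
`b_t = x + ∫_0^t ((r+β) p_s − α_s) ds`, with `p` the running infimum of `b`. -/
def SimpleBal (r β T x : ℝ) (α b : ℝ → ℝ) : Prop :=
  ContinuousOn b (Icc (0:ℝ) T) ∧
  ∀ t ∈ Icc (0:ℝ) T, b t = x + ∫ s in (0:ℝ)..t, ((r + β) * runInf b s - α s)

/-- First time of principal repayment, with `inf ∅ = T`. -/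
def thetaS (T x : ℝ) (b : ℝ → ℝ) : ℝ :=
  sInf (insert T {t | t ∈ Icc (0:ℝ) T ∧ runInf b t < x})

/-- Terminal time in the simple-interest model. -/
def tauS (T : ℝ) (b : ℝ → ℝ) : ℝ :=
  sInf (insert T {t | t ∈ Icc (0:ℝ) T ∧ b t = 0})

/-- Repayment cost in the simple-interest model. -/
def costS (r T ω : ℝ) (α b : ℝ → ℝ) : ℝ :=
  (∫ t in (0:ℝ)..(tauS T b), Real.exp (-r * t) * α t)
    + ω * Real.exp (-r * tauS T b) * b (tauS T b)

section RunningInfimum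

variable {b : ℝ → ℝ} {T x : ℝ}

lemma runInf_le (hb : ContinuousOn b (Icc 0 T)) {s t : ℝ} (hs : 0 ≤ s) (hst : s ≤ t)
    (ht : t ≤ T) : runInf b t ≤ b s :=
  csInf_le ((isCompact_Icc.image_of_continuousOn
    (hb.mono (Icc_subset_Icc_right ht))).bddBelow) ⟨s, ⟨hs, hst⟩, rfl⟩

lemma le_runInf {t : ℝ} (ht : 0 ≤ t) (h : ∀ s ∈ Icc 0 t, x ≤ b s) : x ≤ runInf b t := by
  refine le_csInf ((nonempty_Icc.2 ht).image b) ?_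
  rintro _ ⟨s, hs, rfl⟩
  exact h s hs

lemma antitoneOn_runInf (hb : ContinuousOn b (Icc 0 T)) : AntitoneOn (runInf b) (Icc 0 T) := by
  intro s hs t ht hst
  exact le_runInf hs.1 fun u hu => runInf_le hb hu.1 (hu.2.trans hst) ht.2

lemma intervalIntegrable_runInf (hb : ContinuousOn b (Icc 0 T)) {t : ℝ} (ht : t ∈ Icc 0 T) :
    IntervalIntegrable (runInf b) volume 0 t := by
  apply AntitoneOn.intervalIntegrable
  rw [uIcc_of_le ht.1]
  exact (antitoneOn_runInf hb).mono (Icc_subset_Icc_right ht.2)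

lemma runInf_eq_of_forall_le (hb : ContinuousOn b (Icc 0 T)) (h0 : b 0 = x)
    (h : ∀ t ∈ Icc 0 T, x ≤ b t) {t : ℝ} (ht : t ∈ Icc 0 T) : runInf b t = x :=
  le_antisymm (h0 ▸ runInf_le hb le_rfl ht.1 ht.2)
    (le_runInf ht.1 fun s hs => h s ⟨hs.1, hs.2.trans ht.2⟩)

lemma le_of_thetaS_eq (hT : 0 < T) (hb : ContinuousOn b (Icc 0 T)) (hθ : thetaS T x b = T)
    {t : ℝ} (ht : t ∈ Icc 0 T) : x ≤ b t := by
  have hlt : ∀ s ∈ Ico 0 T, x ≤ b s := by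
    intro s hs
    by_contra! hlt
    have hmem : s ∈ insert T {t | t ∈ Icc (0:ℝ) T ∧ runInf b t < x} :=
      Or.inr ⟨⟨hs.1, hs.2.le⟩, (runInf_le hb hs.1 le_rfl hs.2.le).trans_lt hlt⟩
    have hle : thetaS T x b ≤ s := by
      refine csInf_le ⟨0, ?_⟩ hmem
      rintro u (rfl | hu)
      exacts [hT.le, hu.1.1]
    linarith [hs.2]
  have hcl : closure (Ico 0 T) = Icc 0 T := closure_Ico hT.ne
  rw [← hcl] at ht hb
  have hsub : Ico 0 T ⊆ closure (Ico 0 T) ∩ b ⁻¹' Ici x :=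
    fun s hs => ⟨subset_closure hs, hlt s hs⟩
  exact (closure_minimal hsub
    (hb.preimage_isClosed_of_isClosed isClosed_closure isClosed_Ici) ht).2

lemma tauS_eq_of_forall_ne (h : ∀ t ∈ Icc 0 T, b t ≠ 0) : tauS T b = T := by
  have : {t | t ∈ Icc (0:ℝ) T ∧ b t = 0} = ∅ := by
    ext t
    simpa using fun h0 hT => h t ⟨h0, hT⟩
  rw [tauS, this]
  simp

end RunningInfimum

/-- Grönwall's inequality with zero initial datum, without continuity of `d`. -/
lemma nonpos_of_le_mul_integral {d : ℝ → ℝ} {T K C : ℝ} (hK : 0 ≤ K)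
    (hd : ∀ t ∈ Icc 0 T, IntervalIntegrable d volume 0 t) (hC : ∀ t ∈ Icc 0 T, d t ≤ C)
    (h : ∀ t ∈ Icc 0 T, d t ≤ K * ∫ s in (0:ℝ)..t, d s) {t : ℝ} (ht : t ∈ Icc 0 T) :
    d t ≤ 0 := by
  have key : ∀ n : ℕ, ∀ t ∈ Icc 0 T, d t ≤ C * ((K * t) ^ n / n.factorial) := by
    intro n
    induction n with
    | zero => simpa using hC
    | succ n ih =>
      intro t ht
      have hint : ∫ s in (0:ℝ)..t, d s ≤ ∫ s in (0:ℝ)..t, C * ((K * s) ^ n / n.factorial) :=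
        intervalIntegral.integral_mono_on ht.1 (hd t ht)
          (Continuous.intervalIntegrable (by fun_prop) _ _)
          fun s hs => ih s ⟨hs.1, hs.2.trans ht.2⟩
      have hval : ∫ s in (0:ℝ)..t, C * ((K * s) ^ n / n.factorial)
          = C * (K ^ n / n.factorial * (t ^ (n + 1) / (n + 1))) := by
        have : (fun s : ℝ => C * ((K * s) ^ n / n.factorial))
            = fun s => C * (K ^ n / n.factorial) * s ^ n := by
          ext s; rw [mul_pow]; ring
        rw [this, intervalIntegral.integral_const_mul, integral_pow]
        simp
        ring
      calc d t ≤ K * ∫ s in (0:ℝ)..t, d s := h t ht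
        _ ≤ K * (C * (K ^ n / n.factorial * (t ^ (n + 1) / (n + 1)))) :=
          mul_le_mul_of_nonneg_left (hint.trans_eq hval) hK
        _ = C * ((K * t) ^ (n + 1) / (n + 1).factorial) := by
          rw [Nat.factorial_succ]
          push_cast
          field_simp
          ring
  have hlim := (FloorSemiring.tendsto_pow_div_factorial_atTop (K * t)).const_mul C
  rw [mul_zero] at hlim
  exact ge_of_tendsto' hlim fun n => key n t ht

namespace SimpleBal

variable {r β T x t : ℝ} {α b : ℝ → ℝ}

lemma apply_zero (hb : SimpleBal r β T x α b) (hT : 0 ≤ T) : b 0 = x := by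
  simpa using hb.2 0 ⟨le_rfl, hT⟩

lemma eq_of_forall_le (hb : SimpleBal r β T x α b) (hα : IntervalIntegrable α volume 0 t)
    (h : ∀ t ∈ Icc 0 T, x ≤ b t) (ht : t ∈ Icc 0 T) :
    b t = x + (r + β) * x * t - ∫ s in (0:ℝ)..t, α s := by
  have hcongr : ∫ s in (0:ℝ)..t, ((r + β) * runInf b s - α s)
      = ∫ s in (0:ℝ)..t, ((r + β) * x - α s) := by
    refine intervalIntegral.integral_congr fun s hs => ?_
    rw [uIcc_of_le ht.1] at hs
    simp only [runInf_eq_of_forall_le hb.1 (hb.apply_zero (ht.1.trans ht.2)) h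
      ⟨hs.1, hs.2.trans ht.2⟩]
  rw [hb.2 t ht, hcongr, intervalIntegral.integral_sub (by simp) hα,
    intervalIntegral.integral_const]
  simp
  ring

/-- If interest on the initial principal always covers the cumulative repayments, then the
balance never drops below its initial value. -/
lemma le_of_integral_le (hb : SimpleBal r β T x α b) (hK : 0 ≤ r + β)
    (hα : ∀ t ∈ Icc 0 T, IntervalIntegrable α volume 0 t)
    (h : ∀ t ∈ Icc 0 T, ∫ s in (0:ℝ)..t, α s ≤ (r + β) * x * t) (ht : t ∈ Icc 0 T) :
    x ≤ b t := by
  have hT : 0 ≤ T := ht.1.trans ht.2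
  have hq : ∀ t ∈ Icc 0 T, IntervalIntegrable (runInf b) volume 0 t :=
    fun t ht => intervalIntegrable_runInf hb.1 ht
  have hd : ∀ t ∈ Icc 0 T, IntervalIntegrable (fun s => x - runInf b s) volume 0 t :=
    fun t ht => intervalIntegrable_const.sub (hq t ht)
  have hd0 : ∀ t ∈ Icc 0 T, 0 ≤ x - runInf b t := fun t ht =>
    sub_nonneg.2 (hb.apply_zero hT ▸ runInf_le hb.1 le_rfl ht.1 ht.2)
  have hlow : ∀ t ∈ Icc 0 T, x - (r + β) * ∫ s in (0:ℝ)..t, (x - runInf b s) ≤ b t := by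
    intro t ht
    rw [hb.2 t ht, intervalIntegral.integral_sub ((hq t ht).const_mul _) (hα t ht),
      intervalIntegral.integral_sub (by simp) (hq t ht), intervalIntegral.integral_const_mul,
      intervalIntegral.integral_const]
    simp only [smul_eq_mul, sub_zero]
    linarith [h t ht]
  have hle : ∀ t ∈ Icc 0 T,
      x - runInf b t ≤ (r + β) * ∫ s in (0:ℝ)..t, (x - runInf b s) := by
    intro t ht
    rw [sub_le_comm]
    refine le_runInf ht.1 fun s hs => le_trans ?_ (hlow s ⟨hs.1, hs.2.trans ht.2⟩)
    gcongr
    refine intervalIntegral.integral_mono_interval le_rfl hs.1 hs.2 ?_ (hd t ht)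
    filter_upwards [ae_restrict_mem measurableSet_Ioc] with u hu
    exact hd0 u ⟨hu.1.le, hu.2.trans ht.2⟩
  have hnonpos := nonpos_of_le_mul_integral (C := x - runInf b T) hK hd
    (fun t ht => sub_le_sub_left
      (antitoneOn_runInf hb.1 ht ⟨hT, le_rfl⟩ ht.2) x) hle ht
  linarith [runInf_le hb.1 ht.1 le_rfl ht.2]

end SimpleBal

/-- simple interest: if `θ(α) = T`, then `J(x,m) ≤ J(x,α)`. -/
theorem stmt10 (r β T ω : ℝ) (m M : ℝ → ℝ)
    (hr : 0 < r) (hβ : 0 < β) (hT : 0 < T) (hω : ω ∈ Ioo (0:ℝ) 1)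
    (hmMeas : Measurable m) (hMMeas : Measurable M)
    (hmInt : IntegrableOn m (Icc (0:ℝ) T)) (hMInt : IntegrableOn M (Icc (0:ℝ) T))
    (hmM : ∀ t ∈ Icc (0:ℝ) T, 0 < m t ∧ m t < M t)
    (x : ℝ) (hx : 0 < x)
    (α : ℝ → ℝ) (hα : α ∈ Adm T m M)
    (b : ℝ → ℝ) (hb : SimpleBal r β T x α b)
    (bm : ℝ → ℝ) (hbm : SimpleBal r β T x m bm)
    (hθ : thetaS T x b = T) :
    costS r T ω m bm ≤ costS r T ω α b := by
  have hK : 0 < r + β := by positivity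
  have hαInt : IntegrableOn α (Icc 0 T) := by
    refine hMInt.mono' hα.1.aestronglyMeasurable ?_
    filter_upwards [ae_restrict_mem measurableSet_Icc] with t ht
    rw [Real.norm_eq_abs, abs_of_pos ((hmM t ht).1.trans_le (hα.2 t ht).1)]
    exact (hα.2 t ht).2
  have hint : ∀ {f : ℝ → ℝ}, IntegrableOn f (Icc 0 T) → ∀ t ∈ Icc 0 T,
      IntervalIntegrable f volume 0 t := fun hf t ht =>
    (intervalIntegrable_iff_integrableOn_Icc_of_le ht.1).2
      (hf.mono_set (Icc_subset_Icc_right ht.2))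
  have hTmem : T ∈ Icc 0 T := ⟨hT.le, le_rfl⟩
  have hbx : ∀ t ∈ Icc 0 T, x ≤ b t := fun t ht => le_of_thetaS_eq hT hb.1 hθ ht
  have hbmx : ∀ t ∈ Icc 0 T, x ≤ bm t := by
    refine fun t ht => hbm.le_of_integral_le hK.le (hint hmInt) (fun t ht => ?_) ht
    have hmono := intervalIntegral.integral_mono_on ht.1 (hint hmInt t ht) (hint hαInt t ht)
      fun s hs => (hα.2 s ⟨hs.1, hs.2.trans ht.2⟩).1
    linarith [hbx t ht, hb.eq_of_forall_le (hint hαInt t ht) hbx ht]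
  have hτ : tauS T b = T := tauS_eq_of_forall_ne fun t ht => (hx.trans_le (hbx t ht)).ne'
  have hτm : tauS T bm = T := tauS_eq_of_forall_ne fun t ht => (hx.trans_le (hbmx t ht)).ne'
  have hαT := hint hαInt T hTmem
  have hmT := hint hmInt T hTmem
  have hexp : ContinuousOn (fun t : ℝ => Real.exp (-r * t)) (uIcc 0 T) := by fun_prop
  have hnonneg : 0 ≤ ∫ t in (0:ℝ)..T,
      (Real.exp (-r * t) * (α t - m t) - ω * Real.exp (-r * T) * (α t - m t)) := by
    refine intervalIntegral.integral_nonneg hT.le fun t ht => ?_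
    have hdisc : ω * Real.exp (-r * T) ≤ Real.exp (-r * t) := by
      have hmono : Real.exp (-r * T) ≤ Real.exp (-r * t) :=
        Real.exp_le_exp.2 (by nlinarith [ht.2])
      nlinarith [Real.exp_pos (-r * T), hω.2]
    rw [← sub_mul]
    exact mul_nonneg (sub_nonneg.2 hdisc) (sub_nonneg.2 (hα.2 t ht).1)
  rw [intervalIntegral.integral_sub ((hαT.sub hmT).continuousOn_mul hexp)
    ((hαT.sub hmT).const_mul _), intervalIntegral.integral_const_mul,
    intervalIntegral.integral_sub hαT hmT] at hnonneg
  simp only [mul_sub (Real.exp _)] at hnonneg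
  rw [intervalIntegral.integral_sub (hαT.continuousOn_mul hexp)
    (hmT.continuousOn_mul hexp)] at hnonneg
  rw [costS, costS, hτ, hτm, hb.eq_of_forall_le hαT hbx hTmem,
    hbm.eq_of_forall_le hmT hbmx hTmem]
  linarith
end
end
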